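/- Let A be a unital C*-algebra carrying a strongly continuous circle action σ, let 𝒜 ⊆ A be a norm-dense unital *-subalgebra, let B be a unital C*-algebra and let β_i : 𝒜 → B be a unital ℂ-algebra homomorphism; set β_{-i}(a) := (β_i(a*))*. Let L and L_β : 𝒜 → [0,∞) be slip-norms. Suppose: (1) σ_λ(𝒜) ⊆ 𝒜 for all λ ∈ S¹ and for every a ∈ 𝒜 the quantity L_ℓ(a) := sup_{λ ∈ S¹, λ ≠ 1} ‖σ_λ(a) − a‖/ℓ(λ) is finite; (2) P_0(𝒜) ⊆ 𝒜 and there exist finitely many elements ζ_1^R,…,ζ_k^R ∈ 𝒜 ∩ A_1 and ζ_1^L,…,ζ_m^L ∈ 𝒜 ∩ A_1 with ∑_{j=1}^k ζ_j^R (ζ_j^R)* = 1 = ∑_{j=1}^m (ζ_j^L)* ζ_j^L; (3) there exists C ≥ 0 with L_ℓ(a) ≤ C·L(a) and L_β(a) ≤ C·L(a) for all a ∈ 𝒜; (4) L_β satisfies the twisted Leibniz inequality L_β(ab) ≤ L_β(a)·‖β_i(b)‖ + ‖β_{-i}(a)‖·L_β(b) for all a, b ∈ 𝒜, and the restriction of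 β_i to 𝒜 ∩ A_0 extends to a unital *-homomorphism A_0 → B; (5) L_β is lower semicontinuous for the norm topology on 𝒜 and L_β(σ_λ(a)) = L_β(a) for all λ ∈ S¹ and a ∈ 𝒜; (6) the image of {a ∈ 𝒜 ∩ A_0 : L_β(a) ≤ 1} under the quotient map A_0 → A_0/ℂ·1 is totally bounded. Then the image of {a ∈ 𝒜 : L(a) ≤ 1} under the quotient map A → A/ℂ·1 is totally bounded (equivalently, by Rieffel's characterization, (𝒜, L) is a compact quantum metric space). -/

import Mathlib

/-!
Statement 0 (first main theorem): Under conditions (1)–(6) on a pair of slip-norms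
`L, L_β` on a norm-dense unital *-subalgebra `𝒜` of a unital C*-algebra `A` which
carries a strongly continuous circle action, the image of `{a ∈ 𝒜 : L(a) ≤ 1}` under the
quotient map `A → A/ℂ·1` is totally bounded, i.e. `(𝒜, L)` is a compact quantum metric
space in Rieffel's sense.
-/

noncomputable section

open scoped Real

/-- A strongly continuous action of the circle group on a unital C*-algebra by
*-automorphisms. -/
structure CircleAction (A : Type*) [NormedRing A] [StarRing A] [NormedAlgebra ℂ A] where
  σ : Circle → A → A
  map_one_apply : ∀ a : A, σ 1 a = a
  map_mul_apply : ∀ g h : Circle, ∀ a : A, σ (g * h) a = σ g (σ h a)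
  map_add : ∀ g : Circle, ∀ a b : A, σ g (a + b) = σ g a + σ g b
  map_smul : ∀ g : Circle, ∀ (c : ℂ) (a : A), σ g (c • a) = c • σ g a
  map_mul : ∀ g : Circle, ∀ a b : A, σ g (a * b) = σ g a * σ g b
  map_star : ∀ g : Circle, ∀ a : A, σ g (star a) = star (σ g a)
  map_unit : ∀ g : Circle, σ g 1 = 1
  strong_continuity : ∀ a : A, Continuous fun g : Circle => σ g a

variable {A : Type*} [NormedRing A] [StarRing A] [CStarRing A] [NormedAlgebra ℂ A]
  [StarModule ℂ A] [CompleteSpace A]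

/-- The spectral subspace `A_n`. -/
def specSub (S : CircleAction A) (n : ℤ) : Set A :=
  {a : A | ∀ lam : Circle, S.σ lam a = ((lam : ℂ) ^ n) • a}

/-- The spectral projection `P_n`. -/
def specProj (S : CircleAction A) (n : ℤ) (a : A) : A :=
  (((2 * π)⁻¹ : ℝ) : ℂ) •
    ∫ t in (0 : ℝ)..(2 * π), Complex.exp (-(n : ℂ) * t * Complex.I) • S.σ (Circle.exp t) a

/-- The function `ℓ : S¹ → [0, π]`. -/
def ell (lam : Circle) : ℝ := |Complex.arg (lam : ℂ)|

open Filter Topology MeasureTheory Set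

set_option linter.unusedSectionVars false

namespace CircleAction

theorem map_zero (S : CircleAction A) (g : Circle) : S.σ g 0 = 0 := by
  simpa using S.map_smul g 0 0

theorem norm_apply_le (S : CircleAction A) (g : Circle) (a : A) : ‖S.σ g a‖ ≤ ‖a‖ := by
  let : CStarAlgebra A := { }
  let φ : A →⋆ₐ[ℂ] A :=
    { toFun := S.σ g
      map_one' := S.map_unit g
      map_mul' := S.map_mul g
      map_zero' := S.map_zero g
      map_add' := S.map_add g
      commutes' := fun c => by
        rw [Algebra.algebraMap_eq_smul_one, S.map_smul, S.map_unit]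
      map_star' := S.map_star g }
  exact NonUnitalStarAlgHom.norm_apply_le φ a

/-- The automorphism `σ_λ` as a continuous linear map. -/
def toCLM (S : CircleAction A) (g : Circle) : A →L[ℂ] A :=
  LinearMap.mkContinuous
    { toFun := S.σ g, map_add' := S.map_add g, map_smul' := S.map_smul g } 1
    fun a => by simpa using S.norm_apply_le g a

@[simp] theorem toCLM_apply (S : CircleAction A) (g : Circle) (a : A) :
    S.toCLM g a = S.σ g a := rfl

/-- The fixed point algebra `A_0` as a star subalgebra. -/
def fixedPoints (S : CircleAction A) : StarSubalgebra ℂ A where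
  carrier := specSub S 0
  mul_mem' {a b} ha hb lam := by simp [S.map_mul, ha lam, hb lam]
  add_mem' {a b} ha hb lam := by simp [S.map_add, ha lam, hb lam]
  algebraMap_mem' c lam := by simp [Algebra.algebraMap_eq_smul_one, S.map_smul, S.map_unit]
  star_mem' {a} ha lam := by simp [S.map_star, ha lam]

theorem isClosed_fixedPoints (S : CircleAction A) : IsClosed (S.fixedPoints : Set A) := by
  have : (S.fixedPoints : Set A) = ⋂ lam : Circle, {a : A | S.toCLM lam a = a} := by
    ext a
    simp [fixedPoints, specSub]
  rw [this]
  exact isClosed_iInter fun lam => isClosed_eq (S.toCLM lam).continuous continuous_id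

variable {B : Type*} [NormedRing B] [StarRing B] [CStarRing B] [NormedAlgebra ℂ B]
  [StarModule ℂ B] [CompleteSpace B]

theorem norm_le_of_starHom_fixedPoints (S : CircleAction A) {g : A → B} (hg_one : g 1 = 1)
    (hg_add : ∀ x ∈ specSub S 0, ∀ y ∈ specSub S 0, g (x + y) = g x + g y)
    (hg_smul : ∀ (c : ℂ), ∀ x ∈ specSub S 0, g (c • x) = c • g x)
    (hg_mul : ∀ x ∈ specSub S 0, ∀ y ∈ specSub S 0, g (x * y) = g x * g y)
    (hg_star : ∀ x ∈ specSub S 0, g (star x) = star (g x)) {x : A} (hx : x ∈ specSub S 0) :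
    ‖g x‖ ≤ ‖x‖ := by
  let : CStarAlgebra A := { }
  let : CStarAlgebra B := { }
  have : CompleteSpace S.fixedPoints := S.isClosed_fixedPoints.completeSpace_coe
  let : CStarAlgebra S.fixedPoints := { }
  let φ : S.fixedPoints →⋆ₐ[ℂ] B :=
    { toFun := fun y => g y
      map_one' := hg_one
      map_mul' := fun y z => hg_mul y y.2 z z.2
      map_zero' := by simpa using hg_smul 0 0 S.fixedPoints.zero_mem
      map_add' := fun y z => hg_add y y.2 z z.2
      commutes' := fun c => by
        have h := hg_smul c 1 S.fixedPoints.one_mem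
        rw [hg_one] at h
        simpa [Algebra.algebraMap_eq_smul_one] using h
      map_star' := fun y => hg_star y y.2 }
  exact NonUnitalStarAlgHom.norm_apply_le φ (⟨x, hx⟩ : S.fixedPoints)

end CircleAction

section SpectralSubspace

variable {S : CircleAction A}

theorem mul_mem_specSub {m n : ℤ} {a b : A} (ha : a ∈ specSub S m) (hb : b ∈ specSub S n) :
    a * b ∈ specSub S (m + n) := fun lam => by
  rw [S.map_mul, ha lam, hb lam, smul_mul_smul_comm, zpow_add₀ (Circle.coe_ne_zero lam)]

theorem exists_isometric_row_specSub {𝒜 : StarSubalgebra ℂ A}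
    (h : ∃ (k : ℕ) (ζ : Fin k → A),
      (∀ j, ζ j ∈ 𝒜 ∧ ζ j ∈ specSub S 1) ∧ ∑ j, ζ j * star (ζ j) = 1) (n : ℕ) :
    ∃ (k : ℕ) (ξ : Fin k → A),
      (∀ j, ξ j ∈ 𝒜 ∧ ξ j ∈ specSub S n) ∧ ∑ j, ξ j * star (ξ j) = 1 := by
  induction n with
  | zero =>
    refine ⟨1, fun _ => 1, fun _ => ⟨𝒜.one_mem, fun lam => ?_⟩, by simp⟩
    simp [S.map_unit]
  | succ n ih =>
    obtain ⟨k, ζ, hζ, hζ1⟩ := h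
    obtain ⟨l, ξ, hξ, hξ1⟩ := ih
    refine ⟨l * k, fun j => ξ (finProdFinEquiv.symm j).1 * ζ (finProdFinEquiv.symm j).2,
      fun j => ⟨𝒜.mul_mem (hξ _).1 (hζ _).1, ?_⟩, ?_⟩
    · exact_mod_cast mul_mem_specSub (hξ (finProdFinEquiv.symm j).1).2
        (hζ (finProdFinEquiv.symm j).2).2
    · rw [Equiv.sum_comp finProdFinEquiv.symm
        (fun p : Fin l × Fin k => ξ p.1 * ζ p.2 * star (ξ p.1 * ζ p.2)), Fintype.sum_prod_type]
      rw [← hξ1]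
      refine Finset.sum_congr rfl fun i _ => ?_
      calc ∑ j, ξ i * ζ j * star (ξ i * ζ j) = ξ i * (∑ j, ζ j * star (ζ j)) * star (ξ i) := by
            simp only [star_mul, Finset.mul_sum, Finset.sum_mul, mul_assoc]
        _ = ξ i * star (ξ i) := by rw [hζ1, mul_one]

end SpectralSubspace

theorem Circle.star_coe_zpow (lam : Circle) (n : ℤ) :
    star ((lam : ℂ) ^ n) = (lam : ℂ) ^ (-n) := by
  rw [star_zpow₀, zpow_neg, ← inv_zpow, ← Circle.coe_inv, Circle.coe_inv_eq_conj]
  rfl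

section SpectralProjection

variable (S : CircleAction A)

/-- The integrand of the spectral projection `P_n`, as a function on the circle. -/
def specIntegrand (n : ℤ) (a : A) (lam : Circle) : A := ((lam : ℂ) ^ (-n)) • S.σ lam a

theorem continuous_specIntegrand (n : ℤ) (a : A) : Continuous (specIntegrand S n a) := by
  refine Continuous.smul ?_ (S.strong_continuity a)
  exact continuous_subtype_val.zpow₀ _ fun lam => Or.inl (Circle.coe_ne_zero lam)

theorem continuous_specIntegrand_exp (n : ℤ) (a : A) :
    Continuous fun t : ℝ => specIntegrand S n a (Circle.exp t) :=
  (continuous_specIntegrand S n a).comp Circle.exp.continuous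

theorem specProj_eq_integral (n : ℤ) (a : A) :
    specProj S n a = (((2 * π)⁻¹ : ℝ) : ℂ) •
      ∫ t in (0 : ℝ)..(2 * π), specIntegrand S n a (Circle.exp t) := by
  simp only [specProj, specIntegrand]
  congr 2
  ext t
  rw [Circle.coe_exp, ← Complex.exp_int_mul]
  congr 2
  push_cast
  ring

theorem integral_circle_translate {f : Circle → A} (x : ℝ) :
    ∫ t in x..(x + 2 * π), f (Circle.exp t) = ∫ t in (0 : ℝ)..(2 * π), f (Circle.exp t) := by
  have hp : Function.Periodic (fun t : ℝ => f (Circle.exp t)) (2 * π) :=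
    Circle.periodic_exp.comp f
  simpa using hp.intervalIntegral_add_eq x 0

theorem specProj_eq_integral_symm (n : ℤ) (a : A) :
    specProj S n a = (((2 * π)⁻¹ : ℝ) : ℂ) •
      ∫ t in (-π)..π, specIntegrand S n a (Circle.exp t) := by
  rw [specProj_eq_integral, ← integral_circle_translate (-π)]
  congr 3
  ring

theorem specProj_zero_mem_specSub (a : A) : specProj S 0 a ∈ specSub S 0 := fun lam => by
  obtain ⟨s, rfl⟩ := Circle.exp_surjective lam
  rw [specProj_eq_integral, ← S.toCLM_apply, ContinuousLinearMap.map_smul,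
    ← ContinuousLinearMap.intervalIntegral_comp_comm _
      ((continuous_specIntegrand_exp S 0 a).intervalIntegrable _ _)]
  have h : ∀ t : ℝ, S.toCLM (Circle.exp s) (specIntegrand S 0 a (Circle.exp t)) =
      specIntegrand S 0 a (Circle.exp (t + s)) := fun t => by
    simp [specIntegrand, ← S.map_mul_apply, add_comm t s, Circle.exp_add]
  simp only [h, zpow_zero, one_smul]
  rw [intervalIntegral.integral_comp_add_right
    (fun t => specIntegrand S 0 a (Circle.exp t)), zero_add, add_comm (2 * π) s,
    integral_circle_translate]

variable {S}

theorem star_mul_specProj {n : ℤ} {x : A} (hx : x ∈ specSub S n) (a : A) :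
    specProj S 0 (star x * a) = star x * specProj S n a := by
  have h := ContinuousLinearMap.intervalIntegral_comp_comm (ContinuousLinearMap.mul ℂ A (star x))
    ((continuous_specIntegrand_exp S n a).intervalIntegrable (μ := volume) 0 (2 * π))
  simp only [ContinuousLinearMap.mul_apply'] at h
  rw [specProj_eq_integral, specProj_eq_integral, mul_smul_comm, ← h]
  congr 2
  ext t
  simp only [specIntegrand, neg_zero, zpow_zero, one_smul, S.map_mul, S.map_star, hx (Circle.exp t),
    star_smul, Circle.star_coe_zpow, smul_mul_assoc, mul_smul_comm]

theorem star_specProj (n : ℤ) (a : A) : star (specProj S n a) = specProj S (-n) (star a) := by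
  rw [specProj_eq_integral, specProj_eq_integral, star_smul]
  have h := ContinuousLinearMap.intervalIntegral_comp_comm
    ((starL' ℝ : A ≃L[ℝ] A) : A →L[ℝ] A)
      ((continuous_specIntegrand_exp S n a).intervalIntegrable (μ := volume) 0 (2 * π))
  simp only [ContinuousLinearEquiv.coe_coe, starL'_apply] at h
  rw [← h]
  congr 2
  · simp
  ext t
  simp only [specIntegrand, star_smul, Circle.star_coe_zpow, S.map_star, neg_neg]

theorem specProj_mem_closure {D : Set A} (hD : Convex ℝ D) {n : ℤ} {a : A}
    (h : ∀ lam : Circle, specIntegrand S n a lam ∈ D) : specProj S n a ∈ closure D := by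
  have hpi : (0 : ℝ) < 2 * π := Real.two_pi_pos
  have := hD.set_average_mem_closure (μ := volume) (t := Ioc 0 (2 * π))
    (f := fun t : ℝ => specIntegrand S n a (Circle.exp t)) (by simp [Real.pi_pos])
    measure_Ioc_lt_top.ne
    (Eventually.of_forall fun t => h _)
    ((continuous_specIntegrand_exp S n a).integrableOn_Ioc)
  rw [setAverage_eq, ← intervalIntegral.integral_of_le hpi.le] at this
  rw [specProj_eq_integral, Complex.coe_smul]
  simpa [measureReal_def, hpi.le, Real.pi_pos.le] using this

theorem integral_circle_zpow {n : ℤ} (hn : n ≠ 0) :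
    ∫ t in (0 : ℝ)..(2 * π), (Circle.exp t : ℂ) ^ (-n) = 0 := by
  have hc : (-(n : ℂ) * Complex.I) ≠ 0 := by simp [hn]
  have h : ∀ t : ℝ, (Circle.exp t : ℂ) ^ (-n) = Complex.exp ((-(n : ℂ) * Complex.I) * t) :=
    fun t => by
      rw [Circle.coe_exp, ← Complex.exp_int_mul]
      congr 1
      push_cast
      ring
  simp only [h]
  rw [integral_exp_mul_complex hc]
  have : Complex.exp (-(n : ℂ) * Complex.I * ((2 * π : ℝ) : ℂ)) = 1 :=
    Complex.exp_eq_one_iff.2 ⟨-n, by push_cast; ring⟩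
  rw [this]
  simp

theorem norm_specProj_le {n : ℤ} (hn : n ≠ 0) {a : A} {M : ℝ}
    (h : ∀ lam : Circle, ‖S.σ lam a - a‖ ≤ M) : ‖specProj S n a‖ ≤ M := by
  have hpi : (0 : ℝ) < 2 * π := Real.two_pi_pos
  have hcont : Continuous fun t : ℝ => (Circle.exp t : ℂ) ^ (-n) :=
    (continuous_subtype_val.comp Circle.exp.continuous).zpow₀ _
      fun t => Or.inl (Circle.coe_ne_zero _)
  have h0 : ∫ t in (0 : ℝ)..(2 * π), (Circle.exp t : ℂ) ^ (-n) • a = 0 := by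
    rw [intervalIntegral.integral_smul_const, integral_circle_zpow hn, zero_smul]
  have h1 : ∫ t in (0 : ℝ)..(2 * π), specIntegrand S n a (Circle.exp t) =
      ∫ t in (0 : ℝ)..(2 * π), (Circle.exp t : ℂ) ^ (-n) • (S.σ (Circle.exp t) a - a) := by
    have hc2 : Continuous fun t : ℝ => (Circle.exp t : ℂ) ^ (-n) • a :=
      hcont.smul continuous_const
    have := intervalIntegral.integral_sub
      ((continuous_specIntegrand_exp S n a).intervalIntegrable (μ := volume) 0 (2 * π))
      (hc2.intervalIntegrable (μ := volume) 0 (2 * π))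
    rw [h0, sub_zero] at this
    rw [← this]
    simp only [specIntegrand, smul_sub]
  have h2 : ‖∫ t in (0 : ℝ)..(2 * π), (Circle.exp t : ℂ) ^ (-n) • (S.σ (Circle.exp t) a - a)‖
      ≤ M * |2 * π - 0| := by
    refine intervalIntegral.norm_integral_le_of_norm_le_const fun t _ => ?_
    rw [norm_smul, norm_zpow, Circle.norm_coe, one_zpow, one_mul]
    exact h _
  rw [specProj_eq_integral, h1, norm_smul, Complex.norm_real, Real.norm_of_nonneg (by positivity)]
  rw [sub_zero, abs_of_pos hpi] at h2
  calc _ ≤ (2 * π)⁻¹ * (M * (2 * π)) := by gcongr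
    _ = M := by field_simp

theorem ofReal_cos_kernel_pow (N : ℕ) (t : ℝ) :
    ((((1 + Real.cos t) / 2) ^ N : ℝ) : ℂ) = ∑ j ∈ Finset.range (2 * N + 1),
      (((2 * N).choose j : ℂ) / 4 ^ N) * (Circle.exp t : ℂ) ^ (-((N : ℤ) - j)) := by
  set z : ℂ := (Circle.exp t : ℂ) with hz
  have hz0 : z ≠ 0 := Circle.coe_ne_zero _
  have hcos : (((1 + Real.cos t) / 2 : ℝ) : ℂ) = (z + 1) ^ 2 * z⁻¹ / 4 := by
    have h2 : Complex.cos t = (z + z⁻¹) / 2 := by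
      rw [Complex.cos, hz, Circle.coe_exp, ← Complex.exp_neg, neg_mul]
    push_cast
    rw [h2]
    field_simp
    ring
  rw [Complex.ofReal_pow, hcos, div_pow, mul_pow, ← pow_mul, add_pow, Finset.sum_mul,
    Finset.sum_div]
  refine Finset.sum_congr rfl fun j _ => ?_
  rw [neg_sub, zpow_sub₀ hz0, zpow_natCast, zpow_natCast, one_pow, inv_pow]
  ring

theorem integral_cos_kernel_smul (N : ℕ) (a : A) :
    ∫ t in (-π)..π, (((1 + Real.cos t) / 2) ^ N : ℝ) • S.σ (Circle.exp t) a =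
      ∑ j ∈ Finset.range (2 * N + 1),
        (2 * π * ((2 * N).choose j : ℂ) / 4 ^ N) • specProj S ((N : ℤ) - j) a := by
  have h : ∀ t : ℝ, (((1 + Real.cos t) / 2) ^ N : ℝ) • S.σ (Circle.exp t) a =
      ∑ j ∈ Finset.range (2 * N + 1),
        (((2 * N).choose j : ℂ) / 4 ^ N) • specIntegrand S ((N : ℤ) - j) a (Circle.exp t) :=
    fun t => by
      rw [← Complex.coe_smul, ofReal_cos_kernel_pow, Finset.sum_smul]
      simp only [specIntegrand, mul_smul]
  have hcont : ∀ j : ℕ, Continuous fun t : ℝ =>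
      (((2 * N).choose j : ℂ) / 4 ^ N) • specIntegrand S ((N : ℤ) - j) a (Circle.exp t) :=
    fun j => (continuous_specIntegrand_exp S _ a).const_smul _
  simp only [h]
  rw [intervalIntegral.integral_finsetSum fun j _ => (hcont j).intervalIntegrable _ _]
  refine Finset.sum_congr rfl fun j _ => ?_
  rw [intervalIntegral.integral_smul, specProj_eq_integral_symm, smul_smul]
  congr 1
  have : (π : ℂ) ≠ 0 := by exact_mod_cast Real.pi_ne_zero
  push_cast
  field_simp

theorem integral_cos_kernel_pos (N : ℕ) :
    0 < ∫ t in (-π)..π, ((1 + Real.cos t) / 2) ^ N := by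
  refine intervalIntegral.integral_pos (by linarith [Real.pi_pos]) (by fun_prop)
    (fun t _ => pow_nonneg (by linarith [Real.neg_one_le_cos t]) _)
    ⟨0, ⟨by linarith [Real.pi_pos], Real.pi_pos.le⟩, by simp⟩

theorem tendsto_cos_kernel_abs :
    Tendsto (fun N : ℕ => (∫ t in (-π)..π, ((1 + Real.cos t) / 2) ^ N)⁻¹ *
      ∫ t in (-π)..π, ((1 + Real.cos t) / 2) ^ N * |t|) atTop (𝓝 0) := by
  have hpi := Real.pi_pos
  have h := tendsto_setIntegral_pow_smul_of_unique_maximum_of_isCompact_of_continuousOn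
    (μ := (volume : Measure ℝ)) (s := Icc (-π) π) (x₀ := 0)
    (c := fun t => (1 + Real.cos t) / 2) (g := fun t : ℝ => |t|) isCompact_Icc
    (by fun_prop) (fun t ht ht0 => ?_) (fun t _ => by linarith [Real.neg_one_le_cos t])
    (by simp) ?_ (by fun_prop)
  · simpa [integral_Icc_eq_integral_Ioc,
      intervalIntegral.integral_of_le (show -π ≤ π by linarith)] using h
  · have hlt : Real.cos t < 1 := by
      refine lt_of_le_of_ne (Real.cos_le_one t) fun h => ht0 ?_
      exact (Real.cos_eq_one_iff_of_lt_of_lt (by linarith [ht.1]) (by linarith [ht.2])).1 h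
    simp only [Real.cos_zero]
    linarith
  · rw [interior_Icc]
    exact subset_closure ⟨by linarith, hpi⟩

variable (S) in
/-- Elements that are uniformly Lipschitz along the action are uniformly approximated by
trigonometric sums of their spectral components. -/
theorem exists_norm_sum_specProj_sub_le {ε : ℝ} (hε : 0 < ε) :
    ∃ (N : ℕ) (w : ℕ → ℂ), ∀ (a : A) (M : ℝ), (∀ t ∈ Icc (-π) π,
      ‖S.σ (Circle.exp t) a - a‖ ≤ M * |t|) →
      ‖∑ j ∈ Finset.range (2 * N + 1), w j • specProj S ((N : ℤ) - j) a - a‖ ≤ M * ε := by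
  obtain ⟨N, hN⟩ := ((tendsto_order.1 tendsto_cos_kernel_abs).2 ε hε).exists
  have hpi := Real.pi_pos
  set c : ℝ → ℝ := fun t => ((1 + Real.cos t) / 2) ^ N
  have hc_nonneg : ∀ t, 0 ≤ c t := fun t => pow_nonneg (by linarith [Real.neg_one_le_cos t]) _
  have hc_cont : Continuous c := by fun_prop
  set I : ℝ := ∫ t in (-π)..π, c t with hI
  have hI_pos : 0 < I := integral_cos_kernel_pos N
  refine ⟨N, fun j => (I⁻¹ : ℝ) * (2 * π * ((2 * N).choose j : ℂ) / 4 ^ N), fun a M h => ?_⟩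
  have hM : 0 ≤ M := by
    have := (norm_nonneg _).trans (h π ⟨by linarith, le_rfl⟩)
    rw [abs_of_pos hpi] at this
    exact nonneg_of_mul_nonneg_left this hpi
  have hσ : Continuous fun t : ℝ => S.σ (Circle.exp t) a :=
    (S.strong_continuity a).comp Circle.exp.continuous
  have hsum : ∑ j ∈ Finset.range (2 * N + 1),
      ((I⁻¹ : ℝ) * (2 * π * ((2 * N).choose j : ℂ) / 4 ^ N)) • specProj S ((N : ℤ) - j) a - a =
      I⁻¹ • ∫ t in (-π)..π, c t • (S.σ (Circle.exp t) a - a) := by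
    have h1 : Continuous fun t : ℝ => c t • S.σ (Circle.exp t) a := hc_cont.smul hσ
    have h2 : Continuous fun t : ℝ => c t • a := hc_cont.smul continuous_const
    simp only [mul_smul, ← Finset.smul_sum, smul_sub]
    rw [← integral_cos_kernel_smul, Complex.coe_smul, intervalIntegral.integral_sub
      (h1.intervalIntegrable _ _) (h2.intervalIntegrable _ _),
      intervalIntegral.integral_smul_const, smul_sub, ← hI, inv_smul_smul₀ hI_pos.ne']
  have hbound : ‖∫ t in (-π)..π, c t • (S.σ (Circle.exp t) a - a)‖ ≤
      ∫ t in (-π)..π, M * (c t * |t|) := by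
    refine intervalIntegral.norm_integral_le_of_norm_le (by linarith)
      (Eventually.of_forall fun t ht => ?_) (Continuous.intervalIntegrable (by fun_prop) _ _)
    rw [norm_smul, Real.norm_of_nonneg (hc_nonneg t), mul_left_comm]
    exact mul_le_mul_of_nonneg_left (h t ⟨ht.1.le, ht.2⟩) (hc_nonneg t)
  rw [intervalIntegral.integral_const_mul] at hbound
  rw [hsum, norm_smul, Real.norm_of_nonneg (by positivity)]
  calc I⁻¹ * ‖∫ t in (-π)..π, c t • (S.σ (Circle.exp t) a - a)‖
      ≤ I⁻¹ * (M * ∫ t in (-π)..π, c t * |t|) := by gcongr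
    _ = M * (I⁻¹ * ∫ t in (-π)..π, c t * |t|) := by ring
    _ ≤ M * ε := by gcongr

theorem specProj_eq_sum {n : ℤ} {k : ℕ} {ξ : Fin k → A} (hξ : ∀ j, ξ j ∈ specSub S n)
    (hξ1 : ∑ j, ξ j * star (ξ j) = 1) (a : A) :
    specProj S n a = ∑ j, ξ j * specProj S 0 (star (ξ j) * a) := by
  simp only [star_mul_specProj (hξ _), ← mul_assoc]
  rw [← Finset.sum_mul, hξ1, one_mul]

/-- A lower semicontinuous circle-invariant seminorm is not increased by spectral projections. -/
theorem seminorm_specProj_le {𝒜 : StarSubalgebra ℂ A} {p : A → ℝ}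
    (hp_add : ∀ a ∈ 𝒜, ∀ b ∈ 𝒜, p (a + b) ≤ p a + p b)
    (hp_smul : ∀ (c : ℂ), ∀ a ∈ 𝒜, p (c • a) = ‖c‖ * p a)
    (hp_lsc : LowerSemicontinuousOn p (𝒜 : Set A))
    (hp_inv : ∀ lam : Circle, ∀ a ∈ 𝒜, p (S.σ lam a) = p a)
    (h𝒜 : ∀ lam : Circle, ∀ a ∈ 𝒜, S.σ lam a ∈ 𝒜) {n : ℤ} {a : A} (ha : a ∈ 𝒜)
    (hna : specProj S n a ∈ 𝒜) : p (specProj S n a) ≤ p a := by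
  set D : Set A := {x | x ∈ 𝒜 ∧ p x ≤ p a}
  have hD : Convex ℝ D := by
    rintro x ⟨hx, hxp⟩ y ⟨hy, hyp⟩ s t hs ht hst
    rw [← Complex.coe_smul s, ← Complex.coe_smul t]
    have hsx := 𝒜.smul_mem hx (s : ℂ)
    have hty := 𝒜.smul_mem hy (t : ℂ)
    refine ⟨𝒜.add_mem hsx hty, (hp_add _ hsx _ hty).trans ?_⟩
    rw [hp_smul _ _ hx, hp_smul _ _ hy, Complex.norm_of_nonneg hs, Complex.norm_of_nonneg ht]
    calc s * p x + t * p y ≤ s * p a + t * p a := by gcongr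
      _ = p a := by rw [← add_mul, hst, one_mul]
  have hmem : specProj S n a ∈ closure D := specProj_mem_closure hD fun lam =>
    ⟨𝒜.smul_mem (h𝒜 lam a ha) _, by
      rw [specIntegrand, hp_smul _ _ (h𝒜 lam a ha), hp_inv lam a ha, norm_zpow, Circle.norm_coe,
        one_zpow, one_mul]⟩
  by_contra! hlt
  have hev := hp_lsc _ hna _ hlt
  rw [mem_closure_iff_frequently] at hmem
  obtain ⟨x, hx, hx'⟩ := (hmem.and_eventually (eventually_nhdsWithin_iff.1 hev)).exists
  exact absurd (hx' hx.1) (not_lt.2 hx.2)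

end SpectralProjection

section TotallyBounded

variable {E : Type*} [SeminormedAddCommGroup E]

theorem TotallyBounded.add_of_seminormed {s t : Set E} (hs : TotallyBounded s)
    (ht : TotallyBounded t) : TotallyBounded (image2 (· + ·) s t) := by
  rw [Metric.totallyBounded_iff] at *
  intro ε hε
  obtain ⟨u, hu, hsu⟩ := hs (ε / 2) (half_pos hε)
  obtain ⟨v, hv, htv⟩ := ht (ε / 2) (half_pos hε)
  refine ⟨image2 (· + ·) u v, hu.image2 _ hv, ?_⟩
  rintro _ ⟨x, hx, y, hy, rfl⟩
  obtain ⟨x', hx', hxx⟩ := mem_iUnion₂.1 (hsu hx)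
  obtain ⟨y', hy', hyy⟩ := mem_iUnion₂.1 (htv hy)
  refine mem_iUnion₂.2 ⟨x' + y', mem_image2_of_mem hx' hy', ?_⟩
  rw [Metric.mem_ball] at *
  linarith [dist_add_add_le x y x' y']

theorem totallyBounded_image_finset_sum {ι α : Type*} (s : Finset ι) {f : ι → α → E} {X : Set α}
    (h : ∀ i ∈ s, TotallyBounded (f i '' X)) :
    TotallyBounded ((fun a => ∑ i ∈ s, f i a) '' X) := by
  classical
  induction s using Finset.induction_on with
  | empty =>
    refine (totallyBounded_singleton (0 : E)).subset ?_
    rintro _ ⟨a, _, rfl⟩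
    simp
  | insert i s hi ih =>
    have := (h i (Finset.mem_insert_self i s)).add_of_seminormed
      (ih fun j hj => h j (Finset.mem_insert_of_mem hj))
    refine this.subset ?_
    rintro _ ⟨a, ha, rfl⟩
    simp only [Finset.sum_insert hi]
    exact mem_image2_of_mem (mem_image_of_mem _ ha) ⟨a, ha, rfl⟩

theorem totallyBounded_of_forall_exists_approx {s : Set E}
    (h : ∀ ε > 0, ∃ T, TotallyBounded T ∧ ∀ x ∈ s, ∃ y ∈ T, ‖y - x‖ ≤ ε) :
    TotallyBounded s := by
  rw [Metric.totallyBounded_iff]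
  intro ε hε
  obtain ⟨T, hT, hsT⟩ := h (ε / 2) (half_pos hε)
  obtain ⟨u, hu, hTu⟩ := Metric.totallyBounded_iff.1 hT (ε / 2) (half_pos hε)
  refine ⟨u, hu, fun x hx => ?_⟩
  obtain ⟨y, hy, hxy⟩ := hsT x hx
  obtain ⟨z, hz, hyz⟩ := mem_iUnion₂.1 (hTu hy)
  refine mem_iUnion₂.2 ⟨z, hz, ?_⟩
  rw [Metric.mem_ball] at *
  rw [← dist_eq_norm] at hxy
  linarith [dist_triangle_left x z y]

/-- A bounded set is totally bounded if it is so modulo a finite-dimensional subspace. -/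
theorem totallyBounded_of_mkQ_image {E : Type*} [NormedAddCommGroup E] [NormedSpace ℂ E]
    (V : Submodule ℂ E) [FiniteDimensional ℂ V] {s : Set E} {R : ℝ} (hR : ∀ x ∈ s, ‖x‖ ≤ R)
    (hs : TotallyBounded (V.mkQ '' s)) : TotallyBounded s := by
  refine totallyBounded_of_forall_exists_approx fun ε hε => ?_
  obtain ⟨u, hu, hsu⟩ := Metric.totallyBounded_iff.1 hs ε hε
  have : ProperSpace V := FiniteDimensional.proper ℂ V
  let r : E ⧸ V → E := Function.surjInv V.mkQ_surjective
  refine ⟨⋃ q ∈ u, (fun v : V => r q + v) '' Metric.closedBall 0 (R + ‖r q‖ + ε),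
    (totallyBounded_biUnion hu).2 fun q _ => ((isCompact_closedBall _ _).image
      (by fun_prop)).totallyBounded, fun x hx => ?_⟩
  obtain ⟨q, hq, hxq⟩ := mem_iUnion₂.1 (hsu (mem_image_of_mem _ hx))
  have hrq : V.mkQ (r q) = q := Function.surjInv_eq V.mkQ_surjective q
  rw [Metric.mem_ball, dist_eq_norm, ← hrq, ← map_sub] at hxq
  obtain ⟨m, hm, hmε⟩ := Submodule.Quotient.norm_mk_lt (V.mkQ (x - r q)) (sub_pos.2 hxq)
  have hmε' : ‖m‖ < ε := by linarith
  have hv : x - r q - m ∈ V := (Submodule.Quotient.eq V).1 hm.symm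
  refine ⟨r q + (x - r q - m), mem_iUnion₂.2 ⟨q, hq, ⟨_, hv⟩, ?_, rfl⟩, ?_⟩
  · rw [mem_closedBall_zero_iff]
    change ‖x - r q - m‖ ≤ _
    linarith [norm_sub_le (x - r q) m, norm_sub_le x (r q), hR x hx]
  · rw [show r q + (x - r q - m) - x = -m by abel, norm_neg]
    exact hmε'.le

end TotallyBounded

theorem ell_circle_exp_le {t : ℝ} (ht : t ∈ Icc (-π) π) : ell (Circle.exp t) ≤ |t| := by
  rcases ht.1.eq_or_lt with h | h
  · rw [← h, abs_neg, abs_of_pos Real.pi_pos]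
    exact Complex.abs_arg_le_pi _
  · rw [ell, Circle.arg_exp h ht.2]

theorem ell_pos {lam : Circle} (h : lam ≠ 1) : 0 < ell lam := by
  refine abs_pos.2 fun h0 => h ?_
  rw [← Circle.exp_arg lam, h0, Circle.exp_zero]

section Components

variable {S : CircleAction A} {𝒜 : StarSubalgebra ℂ A}
  {B : Type*} [NormedRing B] {f : A → B} {p : A → ℝ}

theorem norm_map_specProj_le (hf_add : ∀ a ∈ 𝒜, ∀ b ∈ 𝒜, f (a + b) = f a + f b)
    (hf_mul : ∀ a ∈ 𝒜, ∀ b ∈ 𝒜, f (a * b) = f a * f b)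
    (hf_norm : ∀ a ∈ 𝒜, a ∈ specSub S 0 → ‖f a‖ ≤ ‖a‖)
    (hP : ∀ a ∈ 𝒜, specProj S 0 a ∈ 𝒜) {n : ℤ} {k : ℕ} {ξ : Fin k → A}
    (hξ : ∀ j, ξ j ∈ 𝒜 ∧ ξ j ∈ specSub S n) (hξ1 : ∑ j, ξ j * star (ξ j) = 1)
    {a : A} (ha : a ∈ 𝒜) :
    ‖f (specProj S n a)‖ ≤ (∑ j, ‖f (ξ j)‖ * ‖ξ j‖) * ‖specProj S n a‖ := by
  have hf_zero : f 0 = 0 := by simpa using hf_add 0 𝒜.zero_mem 0 𝒜.zero_mem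
  let φ : 𝒜 →+ B :=
    { toFun := fun x => f x
      map_zero' := hf_zero
      map_add' := fun x y => hf_add x x.2 y y.2 }
  have hy : ∀ j, specProj S 0 (star (ξ j) * a) ∈ 𝒜 := fun j =>
    hP _ (mul_mem (star_mem (hξ j).1) ha)
  have hsum : f (specProj S n a) = ∑ j, f (ξ j) * f (specProj S 0 (star (ξ j) * a)) := by
    have h := map_sum φ (fun j => (⟨_, mul_mem (hξ j).1 (hy j)⟩ : 𝒜)) Finset.univ
    simp only [φ, AddMonoidHom.coe_mk, ZeroHom.coe_mk, AddSubmonoidClass.coe_finsetSum] at h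
    rw [specProj_eq_sum (fun j => (hξ j).2) hξ1 a, h]
    exact Finset.sum_congr rfl fun j _ => hf_mul _ (hξ j).1 _ (hy j)
  rw [hsum, Finset.sum_mul]
  refine (norm_sum_le _ _).trans (Finset.sum_le_sum fun j _ => (norm_mul_le _ _).trans ?_)
  rw [mul_assoc]
  gcongr
  refine (hf_norm _ (hy j) (specProj_zero_mem_specSub S _)).trans ?_
  rw [star_mul_specProj (hξ j).2]
  exact (norm_mul_le _ _).trans_eq (by rw [norm_star])

theorem totallyBounded_specProj_image [StarRing B]
    (hf_add : ∀ a ∈ 𝒜, ∀ b ∈ 𝒜, f (a + b) = f a + f b)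
    (hf_mul : ∀ a ∈ 𝒜, ∀ b ∈ 𝒜, f (a * b) = f a * f b)
    (hf_norm : ∀ a ∈ 𝒜, a ∈ specSub S 0 → ‖f a‖ ≤ ‖a‖)
    (hP : ∀ a ∈ 𝒜, specProj S 0 a ∈ 𝒜)
    (hp_nonneg : ∀ a ∈ 𝒜, 0 ≤ p a)
    (hp_proj : ∀ n : ℤ, ∀ a ∈ 𝒜, specProj S n a ∈ 𝒜 → p (specProj S n a) ≤ p a)
    (hp_mul : ∀ a ∈ 𝒜, ∀ b ∈ 𝒜, p (a * b) ≤ p a * ‖f b‖ + ‖star (f (star a))‖ * p b)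
    (hp_tb : ∀ K R : ℝ, TotallyBounded {a : A | a ∈ 𝒜 ∧ a ∈ specSub S 0 ∧ p a ≤ K ∧ ‖a‖ ≤ R})
    {n : ℤ} (hn : n ≠ 0) {k : ℕ} {ξ : Fin k → A}
    (hξ : ∀ j, ξ j ∈ 𝒜 ∧ ξ j ∈ specSub S n) (hξ1 : ∑ j, ξ j * star (ξ j) = 1)
    {X : Set A} (hX : X ⊆ 𝒜) {C M : ℝ} (hXp : ∀ a ∈ X, p a ≤ C)
    (hXM : ∀ a ∈ X, ∀ lam : Circle, ‖S.σ lam a - a‖ ≤ M) :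
    TotallyBounded (specProj S n '' X) := by
  have hfun : specProj S n = fun a => ∑ j, ξ j * specProj S 0 (star (ξ j) * a) :=
    funext fun a => specProj_eq_sum (fun j => (hξ j).2) hξ1 a
  rw [hfun]
  refine totallyBounded_image_finset_sum _ fun j _ => ?_
  set F := ∑ j, ‖f (ξ j)‖ * ‖ξ j‖
  have hF : 0 ≤ F := Finset.sum_nonneg fun _ _ => by positivity
  have hstar : star (ξ j) ∈ 𝒜 := star_mem (hξ j).1
  refine ((hp_tb (p (star (ξ j)) * (F * M) + ‖star (f (star (star (ξ j))))‖ * C)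
    (‖ξ j‖ * M)).image (f := fun y => ξ j * y)
      (ContinuousLinearMap.mul ℂ A (ξ j)).uniformContinuous).subset ?_
  rintro _ ⟨a, ha, rfl⟩
  have ha𝒜 : a ∈ 𝒜 := hX ha
  have hy : star (ξ j) * a ∈ 𝒜 := mul_mem hstar ha𝒜
  have hPn : specProj S n a ∈ 𝒜 := by
    rw [hfun]
    exact sum_mem fun i _ => mul_mem (hξ i).1 (hP _ (mul_mem (star_mem (hξ i).1) ha𝒜))
  have hPM : ‖specProj S n a‖ ≤ M := norm_specProj_le hn (hXM a ha)
  refine ⟨_, ⟨hP _ hy, specProj_zero_mem_specSub S _, ?_, ?_⟩, rfl⟩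
  · rw [star_mul_specProj (hξ j).2]
    refine (hp_mul _ hstar _ hPn).trans ?_
    have h0 := hp_nonneg _ hstar
    have h1 : ‖f (specProj S n a)‖ ≤ F * M :=
      (norm_map_specProj_le hf_add hf_mul hf_norm hP hξ hξ1 ha𝒜).trans (by gcongr)
    have h2 : p (specProj S n a) ≤ C := (hp_proj n a ha𝒜 hPn).trans (hXp a ha)
    gcongr
  · rw [star_mul_specProj (hξ j).2]
    refine (norm_mul_le _ _).trans ?_
    rw [norm_star]
    gcongr

end Components

theorem first_main_theorem
    (S : CircleAction A) (𝒜 : StarSubalgebra ℂ A) (hdense : Dense (𝒜 : Set A))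
    {B : Type*} [NormedRing B] [StarRing B] [CStarRing B] [NormedAlgebra ℂ B]
    [StarModule ℂ B] [CompleteSpace B]
    -- `β_i : 𝒜 → B` a unital ℂ-algebra homomorphism; `β_{-i}(a) := (β_i(a*))*`
    (βi : A → B)
    (hβi_one : βi 1 = 1)
    (hβi_add : ∀ a ∈ 𝒜, ∀ b ∈ 𝒜, βi (a + b) = βi a + βi b)
    (hβi_smul : ∀ (c : ℂ), ∀ a ∈ 𝒜, βi (c • a) = c • βi a)
    (hβi_mul : ∀ a ∈ 𝒜, ∀ b ∈ 𝒜, βi (a * b) = βi a * βi b)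
    -- `L` and `L_β` are slip-norms on `𝒜`
    (L Lβ : A → ℝ)
    (hL_nonneg : ∀ a ∈ 𝒜, 0 ≤ L a)
    (hL_add : ∀ a ∈ 𝒜, ∀ b ∈ 𝒜, L (a + b) ≤ L a + L b)
    (hL_smul : ∀ (c : ℂ), ∀ a ∈ 𝒜, L (c • a) = ‖c‖ * L a)
    (hL_one : L 1 = 0)
    (hL_star : ∀ a ∈ 𝒜, L (star a) = L a)
    (hLβ_nonneg : ∀ a ∈ 𝒜, 0 ≤ Lβ a)
    (hLβ_add : ∀ a ∈ 𝒜, ∀ b ∈ 𝒜, Lβ (a + b) ≤ Lβ a + Lβ b)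
    (hLβ_smul : ∀ (c : ℂ), ∀ a ∈ 𝒜, Lβ (c • a) = ‖c‖ * Lβ a)
    (hLβ_one : Lβ 1 = 0)
    (hLβ_star : ∀ a ∈ 𝒜, Lβ (star a) = Lβ a)
    -- (1) `σ_λ(𝒜) ⊆ 𝒜` and `𝒜 ⊆ Lip_{S¹}(A)`
    (h1a : ∀ lam : Circle, ∀ a ∈ 𝒜, S.σ lam a ∈ 𝒜)
    (h1b : ∀ a ∈ 𝒜, ∃ M : ℝ, ∀ lam : Circle, lam ≠ 1 → ‖S.σ lam a - a‖ ≤ M * ell lam)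
    -- (2) `P_0(𝒜) ⊆ 𝒜` and the two finite families in `𝒜 ∩ A_1`
    (h2a : ∀ a ∈ 𝒜, specProj S 0 a ∈ 𝒜)
    (h2b : ∃ (k : ℕ) (ζR : Fin k → A),
      (∀ j, ζR j ∈ 𝒜 ∧ ζR j ∈ specSub S 1) ∧ ∑ j, ζR j * star (ζR j) = 1)
    (h2c : ∃ (m : ℕ) (ζL : Fin m → A),
      (∀ j, ζL j ∈ 𝒜 ∧ ζL j ∈ specSub S 1) ∧ ∑ j, star (ζL j) * ζL j = 1)
    -- (3) `L_ℓ(a) ≤ C·L(a)` and `L_β(a) ≤ C·L(a)` on `𝒜`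
    (C : ℝ) (hC : 0 ≤ C)
    (h3a : ∀ a ∈ 𝒜, ∀ lam : Circle, lam ≠ 1 → ‖S.σ lam a - a‖ / ell lam ≤ C * L a)
    (h3b : ∀ a ∈ 𝒜, Lβ a ≤ C * L a)
    -- (4) the twisted Leibniz inequality and the extension of `β_i|_{𝒜 ∩ A_0}` to a
    -- unital *-homomorphism `A_0 → B`
    (h4a : ∀ a ∈ 𝒜, ∀ b ∈ 𝒜,
      Lβ (a * b) ≤ Lβ a * ‖βi b‖ + ‖star (βi (star a))‖ * Lβ b)
    (h4b : ∃ g : A → B,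
      (∀ a ∈ (𝒜 : Set A) ∩ specSub S 0, g a = βi a) ∧
      g 1 = 1 ∧
      (∀ x ∈ specSub S 0, ∀ y ∈ specSub S 0, g (x + y) = g x + g y) ∧
      (∀ (c : ℂ), ∀ x ∈ specSub S 0, g (c • x) = c • g x) ∧
      (∀ x ∈ specSub S 0, ∀ y ∈ specSub S 0, g (x * y) = g x * g y) ∧
      (∀ x ∈ specSub S 0, g (star x) = star (g x)))
    -- (5) `L_β` is lower semicontinuous on `𝒜` and circle-invariant
    (h5a : LowerSemicontinuousOn Lβ (𝒜 : Set A))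
    (h5b : ∀ lam : Circle, ∀ a ∈ 𝒜, Lβ (S.σ lam a) = Lβ a)
    -- (6) `(𝒜 ∩ A_0, L_β)` is a compact quantum metric space
    (h6 : TotallyBounded
      (⇑(Submodule.span ℂ ({1} : Set A)).mkQ ''
        {a : A | a ∈ 𝒜 ∧ a ∈ specSub S 0 ∧ Lβ a ≤ 1})) :
    TotallyBounded
      (⇑(Submodule.span ℂ ({1} : Set A)).mkQ '' {a : A | a ∈ 𝒜 ∧ L a ≤ 1}) := by
  set V := Submodule.span ℂ ({1} : Set A)
  set X : Set A := {a | a ∈ 𝒜 ∧ L a ≤ 1}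
  obtain ⟨g, hgβ, hg_one, hg_add, hg_smul, hg_mul, hg_star⟩ := h4b
  have hX_lip : ∀ a ∈ X, ∀ lam : Circle, ‖S.σ lam a - a‖ ≤ C * ell lam := by
    intro a ha lam
    rcases eq_or_ne lam 1 with rfl | hlam
    · rw [S.map_one_apply, sub_self, norm_zero]
      exact mul_nonneg hC (abs_nonneg _)
    · have hpos := ell_pos hlam
      refine ((div_le_iff₀ hpos).1 (h3a a ha.1 lam hlam)).trans ?_
      gcongr
      exact mul_le_of_le_one_right hC ha.2
  have hXM : ∀ a ∈ X, ∀ lam : Circle, ‖S.σ lam a - a‖ ≤ C * π := fun a ha lam =>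
    (hX_lip a ha lam).trans (mul_le_mul_of_nonneg_left (Complex.abs_arg_le_pi _) hC)
  have hXβ : ∀ a ∈ X, Lβ a ≤ C := fun a ha =>
    (h3b a ha.1).trans (mul_le_of_le_one_right hC ha.2)
  have hproj : ∀ n : ℤ, ∀ a ∈ 𝒜, specProj S n a ∈ 𝒜 → Lβ (specProj S n a) ≤ Lβ a :=
    fun n a ha => seminorm_specProj_le hLβ_add hLβ_smul h5a h5b h1a ha
  have hβ_norm : ∀ a ∈ 𝒜, a ∈ specSub S 0 → ‖βi a‖ ≤ ‖a‖ := fun a ha ha0 => by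
    rw [← hgβ a ⟨ha, ha0⟩]
    exact S.norm_le_of_starHom_fixedPoints hg_one hg_add hg_smul hg_mul hg_star ha0
  have hQ : ∀ K : ℝ,
      TotallyBounded (V.mkQ '' {a : A | a ∈ 𝒜 ∧ a ∈ specSub S 0 ∧ Lβ a ≤ K}) := by
    intro K
    have hK : (0 : ℝ) < |K| + 1 := by positivity
    have hK0 : ((|K| + 1 : ℝ) : ℂ) ≠ 0 := by exact_mod_cast hK.ne'
    refine (h6.image (uniformContinuous_const_smul ((|K| + 1 : ℝ) : ℂ))).subset ?_
    rintro _ ⟨a, ⟨ha, ha0, haK⟩, rfl⟩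
    refine ⟨_, ⟨((|K| + 1 : ℝ) : ℂ)⁻¹ • a,
      ⟨𝒜.smul_mem ha _, S.fixedPoints.smul_mem ha0 _, ?_⟩, rfl⟩, ?_⟩
    · rw [hLβ_smul _ _ ha, norm_inv, Complex.norm_of_nonneg hK.le, inv_mul_le_one₀ hK]
      linarith [le_abs_self K]
    · simp only [map_smul, smul_inv_smul₀ hK0]
  have htb : ∀ K R : ℝ,
      TotallyBounded {a : A | a ∈ 𝒜 ∧ a ∈ specSub S 0 ∧ Lβ a ≤ K ∧ ‖a‖ ≤ R} := fun K R => by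
    refine totallyBounded_of_mkQ_image V (fun a ha => ha.2.2.2) ((hQ K).subset (image_mono ?_))
    exact fun a ha => ⟨ha.1, ha.2.1, ha.2.2.1⟩
  have hpos : ∀ n : ℕ, n ≠ 0 → TotallyBounded (specProj S n '' X) := fun n hn => by
    obtain ⟨k, ξ, hξ, hξ1⟩ := exists_isometric_row_specSub h2b n
    exact totallyBounded_specProj_image hβi_add hβi_mul hβ_norm h2a hLβ_nonneg hproj h4a htb
      (by exact_mod_cast hn) hξ hξ1 (fun a ha => ha.1) hXβ hXM
  have hmkQ : UniformContinuous V.mkQ :=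
    (LipschitzWith.mk_one fun x y => by
      rw [dist_eq_norm, dist_eq_norm, ← map_sub]
      exact Submodule.Quotient.norm_mk_le _ _).uniformContinuous
  have hcomp : ∀ n : ℤ, TotallyBounded ((fun a => V.mkQ (specProj S n a)) '' X) := by
    intro n
    rw [← image_image V.mkQ]
    rcases lt_trichotomy n 0 with hn | rfl | hn
    · lift -n to ℕ using by omega with m hm
      refine TotallyBounded.image (((hpos m (by omega)).image
        (f := star) (starₗᵢ ℂ : A ≃ₗᵢ⋆[ℂ] A).isometry.uniformContinuous).subset ?_) hmkQ
      rintro _ ⟨a, ha, rfl⟩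
      refine ⟨_, ⟨star a, ⟨star_mem ha.1, (hL_star a ha.1).trans_le ha.2⟩, rfl⟩, ?_⟩
      rw [star_specProj, star_star, hm, neg_neg]
    · refine (hQ C).subset (image_mono ?_)
      rintro _ ⟨a, ha, rfl⟩
      exact ⟨h2a a ha.1, specProj_zero_mem_specSub S a,
        (hproj 0 a ha.1 (h2a a ha.1)).trans (hXβ a ha)⟩
    · lift n to ℕ using hn.le
      exact (hpos n (by omega)).image hmkQ
  refine totallyBounded_of_forall_exists_approx fun ε hε => ?_
  obtain ⟨N, w, hw⟩ := exists_norm_sum_specProj_sub_le S (ε := ε / (C + 1)) (by positivity)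
  refine ⟨_, totallyBounded_image_finset_sum (Finset.range (2 * N + 1))
    (f := fun j a => w j • V.mkQ (specProj S ((N : ℤ) - j) a)) (X := X) fun j _ => ?_, ?_⟩
  · rw [← image_image (fun q => w j • q)]
    exact (hcomp _).image (uniformContinuous_const_smul _)
  · rintro _ ⟨a, ha, rfl⟩
    refine ⟨_, mem_image_of_mem _ ha, ?_⟩
    simp only [← map_smul, ← map_sum, ← map_sub]
    refine (Submodule.Quotient.norm_mk_le _ _).trans ((hw a C fun t ht => ?_).trans ?_)
    · exact (hX_lip a ha _).trans (mul_le_mul_of_nonneg_left (ell_circle_exp_le ht) hC)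
    · rw [mul_div_assoc', div_le_iff₀ (by positivity)]
      nlinarith

end
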